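/- arXiv:2601.13036 — 2 statements merged into one kernel-verified Lean document; each statement's English description precedes it below -/
import Mathlib

section
/- Let (𝔤, σ, J₁, J₂, ω₀) be a quaternionic skew-Hermitian transvection involutive Lie algebra whose underlying finite-dimensional real Lie algebra 𝔤 is simple. Then the center of 𝔩 is nonzero: there exists Z₀ ∈ 𝔤 with Z₀ ≠ 0, σ(Z₀) = Z₀, and ⁅Z₀, x⁆ = 0 for every x ∈ 𝔤 with σ(x) = x. -/
/-- Let `(𝔤, σ, J₁, J₂, ω)` be a quaternionic skew-Hermitian
transvection involutive Lie algebra (qs-H tiLa) with `𝔤` a finite-dimensional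
simple real Lie algebra.  Here `σ` is an involutive Lie algebra automorphism,
`𝔩 = {x | σ x = x}` and `𝔪 = {x | σ x = -x}`, the tiLa conditions are
`𝔩 = ⁅𝔪, 𝔪⁆` and that no nonzero ideal of `𝔤` is contained in `𝔩`, the maps
`J₁, J₂` preserve `𝔪` and define a linear quaternionic structure
`Q₀ = span {J₁, J₂, J₁∘J₂}` on `𝔪` which is `𝔩`-invariant, and `ω` is a
nondegenerate alternating `𝔩`-invariant `Q₀`-Hermitian bilinear form on `𝔪`.
Then the center of `𝔩` is nonzero. -/
theorem qsH_tiLa_simple_center_nonzero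
    (𝔤 : Type*) [LieRing 𝔤] [LieAlgebra ℝ 𝔤]
    [FiniteDimensional ℝ 𝔤] [LieAlgebra.IsSimple ℝ 𝔤]
    (σ : 𝔤 →ₗ⁅ℝ⁆ 𝔤) (hσ : ∀ x, σ (σ x) = x)
    (hlm : ∀ x : 𝔤, σ x = x →
      x ∈ Submodule.span ℝ {z : 𝔤 | ∃ u v : 𝔤, σ u = -u ∧ σ v = -v ∧ z = ⁅u, v⁆})
    (hideal : ∀ I : LieIdeal ℝ 𝔤, (∀ x ∈ I, σ x = x) → I = ⊥)
    (J₁ J₂ : 𝔤 →ₗ[ℝ] 𝔤)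
    (hJ₁m : ∀ x : 𝔤, σ x = -x → σ (J₁ x) = -(J₁ x))
    (hJ₂m : ∀ x : 𝔤, σ x = -x → σ (J₂ x) = -(J₂ x))
    (hJ₁sq : ∀ x : 𝔤, σ x = -x → J₁ (J₁ x) = -x)
    (hJ₂sq : ∀ x : 𝔤, σ x = -x → J₂ (J₂ x) = -x)
    (hanti : ∀ x : 𝔤, σ x = -x → J₁ (J₂ x) = -(J₂ (J₁ x)))
    (ω : 𝔤 →ₗ[ℝ] 𝔤 →ₗ[ℝ] ℝ)
    (hωalt : ∀ x y : 𝔤, σ x = -x → σ y = -y → ω x y = -(ω y x))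
    (hωnd : ∀ z : 𝔤, σ z = -z → (∀ x : 𝔤, σ x = -x → ω x z = 0) → z = 0)
    (hQinv : ∀ a : 𝔤, σ a = a →
      ∀ T ∈ Submodule.span ℝ ({J₁, J₂, J₁ ∘ₗ J₂} : Set (𝔤 →ₗ[ℝ] 𝔤)),
      ∃ S ∈ Submodule.span ℝ ({J₁, J₂, J₁ ∘ₗ J₂} : Set (𝔤 →ₗ[ℝ] 𝔤)),
        ∀ x : 𝔤, σ x = -x → ⁅a, T x⁆ - T ⁅a, x⁆ = S x)
    (hωinv : ∀ a x y : 𝔤, σ a = a → σ x = -x → σ y = -y →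
      ω ⁅a, x⁆ y + ω x ⁅a, y⁆ = 0)
    (hherm₁ : ∀ x y : 𝔤, σ x = -x → σ y = -y → ω (J₁ x) (J₁ y) = ω x y)
    (hherm₂ : ∀ x y : 𝔤, σ x = -x → σ y = -y → ω (J₂ x) (J₂ y) = ω x y) :
    ∃ Z₀ : 𝔤, Z₀ ≠ 0 ∧ σ Z₀ = Z₀ ∧ ∀ x : 𝔤, σ x = x → ⁅Z₀, x⁆ = 0 := by
  classical
  let P : 𝔤 →ₗ[ℝ] 𝔤 := LinearMap.id - (σ : 𝔤 →ₗ[ℝ] 𝔤)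
  have hP : ∀ x, P x = x - σ x := fun x => by simp [P]
  have hPm : ∀ x, σ (P x) = -(P x) := fun x => by rw [hP, map_sub, hσ]; abel
  have hEl : ∀ x, σ (x + σ x) = x + σ x := fun x => by rw [map_add, hσ]; abel
  have hPσ : ∀ x, P (σ x) = -(P x) := fun x => by rw [hP, hP, hσ]; abel
  have hPl : ∀ x, σ x = x → P x = 0 := fun x hx => by rw [hP, hx, sub_self]
  have hPp : ∀ x, σ x = -x → P x = (2 : ℝ) • x := fun x hx => by
    rw [hP, hx, two_smul]; abel
  have hPb : ∀ x y, (2 : ℝ) • P ⁅x, y⁆ = ⁅x + σ x, P y⁆ - ⁅y + σ y, P x⁆ := fun x y => by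
    rw [hP, hP, hP, LieHom.map_lie, two_smul]
    simp only [add_lie, lie_sub]
    rw [← lie_skew y x, ← lie_skew y (σ x), ← lie_skew (σ y) x, ← lie_skew (σ y) (σ x)]
    abel
  let Ω : 𝔤 →ₗ[ℝ] 𝔤 →ₗ[ℝ] ℝ := ω.compl₁₂ P P
  have hΩ : ∀ x y, Ω x y = ω (P x) (P y) := fun x y => by simp [Ω]
  have hcoc : ∀ x y z, Ω ⁅x, y⁆ z = Ω x ⁅y, z⁆ - Ω y ⁅x, z⁆ := by
    intro x y z
    rw [hΩ, hΩ, hΩ]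
    have h1 : (2 : ℝ) * ω (P ⁅x, y⁆) (P z) = ω ((2 : ℝ) • P ⁅x, y⁆) (P z) := by simp
    have h2 : (2 : ℝ) * ω (P x) (P ⁅y, z⁆) = ω (P x) ((2 : ℝ) • P ⁅y, z⁆) := by simp
    have h3 : (2 : ℝ) * ω (P y) (P ⁅x, z⁆) = ω (P y) ((2 : ℝ) • P ⁅x, z⁆) := by simp
    rw [hPb] at h1 h2 h3
    simp only [map_sub, LinearMap.sub_apply] at h1 h2 h3
    have i1 := hωinv _ _ _ (hEl y) (hPm x) (hPm z)
    have i2 := hωinv _ _ _ (hEl x) (hPm y) (hPm z)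
    have i3 := hωinv _ _ _ (hEl z) (hPm x) (hPm y)
    have hm : σ ⁅z + σ z, P x⁆ = -⁅z + σ z, P x⁆ := by
      rw [LieHom.map_lie, hEl, hPm, lie_neg]
    have i4 := hωalt _ _ hm (hPm y)
    linarith
  have hK : LieAlgebra.IsKilling ℝ 𝔤 := inferInstance
  have hnd := LieAlgebra.IsKilling.killingForm_nondegenerate ℝ 𝔤
  have hinv : ∀ x y z : 𝔤, killingForm ℝ 𝔤 ⁅x, y⁆ z = - killingForm ℝ 𝔤 y ⁅x, z⁆ :=
    fun x y z => by
      have h := LieModule.traceForm_apply_lie_apply ℝ 𝔤 𝔤 y x z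
      have h' : killingForm ℝ 𝔤 ⁅y, x⁆ z = killingForm ℝ 𝔤 y ⁅x, z⁆ := h
      rw [← h', ← lie_skew x y, map_neg, LinearMap.neg_apply]
  have hext : ∀ u v : 𝔤, (∀ z, killingForm ℝ 𝔤 u z = killingForm ℝ 𝔤 v z) → u = v := by
    intro u v h
    have := hnd.1 (u - v) (fun z => by simp [h z])
    exact sub_eq_zero.mp this
  let D₀ : 𝔤 →ₗ[ℝ] 𝔤 :=
    ((LinearMap.BilinForm.toDual (killingForm ℝ 𝔤) hnd).symm : _ →ₗ[ℝ] 𝔤) ∘ₗ Ω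
  have hD₀ : ∀ x y, killingForm ℝ 𝔤 (D₀ x) y = Ω x y := fun x y => by
    simp [D₀, LinearMap.BilinForm.apply_toDual_symm_apply]
  let D : LieDerivation ℝ 𝔤 𝔤 :=
    { toLinearMap := D₀
      leibniz' := fun a b => by
        apply hext
        intro z
        rw [map_sub, LinearMap.sub_apply, hinv, hinv, hD₀, hD₀, hD₀, hcoc]
        ring }
  obtain ⟨Z, hZ⟩ := LieDerivation.IsKilling.exists_eq_ad D
  have hZ' : ∀ x, ⁅Z, x⁆ = D₀ x := fun x => by
    have := congrArg (fun E : LieDerivation ℝ 𝔤 𝔤 => E x) hZ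
    simpa [D] using this
  have hZK : ∀ x y, killingForm ℝ 𝔤 ⁅Z, x⁆ y = ω (P x) (P y) := fun x y => by
    rw [hZ', hD₀, hΩ]
  have hcen : ∀ u : 𝔤, (∀ x : 𝔤, ⁅u, x⁆ = 0) → u = 0 := by
    intro u hu
    have h : u ∈ LieAlgebra.center ℝ 𝔤 := by
      rw [LieModule.mem_maxTrivSubmodule]
      intro x
      rw [← lie_skew, hu, neg_zero]
    rw [LieAlgebra.center_eq_bot] at h
    simpa using h
  refine ⟨Z, ?_, ?_, ?_⟩
  · rintro rfl
    have hm0 : ∀ z, σ z = -z → z = 0 := by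
      intro z hz
      apply hωnd z hz
      intro x hx
      have := hZK x z
      rw [hPp x hx, hPp z hz] at this
      simpa using this
    have hl0 : ∀ z, σ z = z → z = 0 := by
      intro z hz
      have h := hlm z hz
      have h2 : Submodule.span ℝ {z : 𝔤 | ∃ u v : 𝔤, σ u = -u ∧ σ v = -v ∧ z = ⁅u, v⁆} ≤ ⊥ := by
        rw [Submodule.span_le]
        rintro w ⟨u, v, hu, -, rfl⟩
        simp [hm0 u hu]
      simpa using h2 h
    have h0 : ∀ z : 𝔤, z = 0 := by
      intro z
      apply hl0
      have := hm0 _ (hPm z)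
      rw [hP] at this
      exact (sub_eq_zero.mp this).symm
    exact LieAlgebra.IsSimple.non_abelian (R := ℝ) (L := 𝔤) ⟨fun x y => h0 _⟩
  · let e : 𝔤 ≃ₗ⁅ℝ⁆ 𝔤 := { σ with invFun := σ, left_inv := hσ, right_inv := hσ }
    have he : ∀ x, e x = σ x := fun x => rfl
    have hKσ : ∀ x y, killingForm ℝ 𝔤 (σ x) (σ y) = killingForm ℝ 𝔤 x y := fun x y => by
      rw [← he, ← he, LieAlgebra.killingForm_of_equiv_apply]
    rw [← sub_eq_zero]
    apply hcen
    intro x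
    rw [sub_lie, sub_eq_zero]
    apply hext
    intro y
    rw [← hKσ, LieHom.map_lie, hσ, hZK, hZK, hPσ, hPσ]
    simp
  · intro x hx
    apply hext
    intro y
    rw [hZK, hPl x hx]
    simp
end

section
/- Let (𝔤, σ, J₁, J₂, ω₀) be a quaternionic skew-Hermitian transvection involutive Lie algebra such that the underlying finite-dimensional real Lie algebra 𝔤 is semisimple (equivalently, its Killing form is nondegenerate) and dim_ℝ 𝔪 > 4. Then 𝔤 is a simple Lie algebra. -/
section helper
variable {V L : Type*} [AddCommGroup V] [Module ℝ V] [AddCommGroup L] [Module ℝ L]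

structure QS (J₁ J₂ : Module.End ℝ V) (ω : V →ₗ[ℝ] V →ₗ[ℝ] ℝ)
    (ρ : L →ₗ[ℝ] Module.End ℝ V) (β : V → V → L) : Prop where
  sq1 : J₁ * J₁ = -1
  sq2 : J₂ * J₂ = -1
  anti : J₂ * J₁ = -(J₁ * J₂)
  alt : ∀ x y, ω x y = -ω y x
  nd : ∀ z, (∀ x, ω x z = 0) → z = 0
  herm1 : ∀ x y, ω (J₁ x) (J₁ y) = ω x y
  herm2 : ∀ x y, ω (J₂ x) (J₂ y) = ω x y
  inv : ∀ a x y, ω (ρ a x) y + ω x (ρ a y) = 0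
  Q1 : ∀ a, ∃ c d e : ℝ, ρ a * J₁ - J₁ * ρ a = c • J₁ + d • J₂ + e • (J₁ * J₂)
  Q2 : ∀ a, ∃ c d e : ℝ, ρ a * J₂ - J₂ * ρ a = c • J₁ + d • J₂ + e • (J₁ * J₂)
  skew : ∀ x y, β x y = -β y x
  jac : ∀ x y z, ρ (β x y) z + ρ (β y z) x + ρ (β z x) y = 0

structure Half (ω : V →ₗ[ℝ] V →ₗ[ℝ] ℝ)
    (ρ : L →ₗ[ℝ] Module.End ℝ V) (β : V → V → L) (VA VB : Submodule ℝ V) (LA : Set L) : Prop where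
  kill : ∀ a ∈ LA, ∀ x ∈ VB, ρ a x = 0
  maps : ∀ a ∈ LA, ∀ x, ρ a x ∈ VA
  br : ∀ x ∈ VA, ∀ y ∈ VA, β x y ∈ LA
  key : ∀ x, (∀ a ∈ LA, ρ a x = 0) → ∀ y ∈ VA, ω y x = 0
  gen : ∀ x ∈ VA, (∀ u ∈ VA, ∀ v ∈ VA, ρ (β u v) x = 0) → ∀ a ∈ LA, ρ a x = 0

/-- imaginary quaternion -/
def Jv (J₁ J₂ : Module.End ℝ V) (p q r : ℝ) : Module.End ℝ V := p • J₁ + q • J₂ + r • (J₁ * J₂)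

lemma Jv_mul {J₁ J₂ : Module.End ℝ V} (sq1 : J₁ * J₁ = -1) (sq2 : J₂ * J₂ = -1)
    (anti : J₂ * J₁ = -(J₁ * J₂)) (p q r p' q' r' : ℝ) :
    Jv J₁ J₂ p q r * Jv J₁ J₂ p' q' r' = -(p*p'+q*q'+r*r') • (1 : Module.End ℝ V)
      + Jv J₁ J₂ (q*r'-r*q') (r*p'-p*r') (p*q'-q*p') := by
  have h13 : J₁ * (J₁ * J₂) = -J₂ := by rw [← mul_assoc, sq1]; simp
  have h31 : J₁ * J₂ * J₁ = J₂ := by rw [mul_assoc, anti, mul_neg, h13]; simp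
  have h32 : J₁ * J₂ * J₂ = -J₁ := by rw [mul_assoc, sq2]; simp
  have h23 : J₂ * (J₁ * J₂) = J₁ := by rw [← mul_assoc, anti, neg_mul, h32]; simp
  have h33 : J₁ * J₂ * (J₁ * J₂) = -1 := by rw [mul_assoc, h23, sq1]
  simp only [Jv, add_mul, mul_add, smul_mul_smul_comm, sq1, sq2, anti, h13, h31, h32, h23, h33]
  module

lemma Jv_inj {J₁ J₂ : Module.End ℝ V} (sq1 : J₁ * J₁ = -1) (sq2 : J₂ * J₂ = -1)
    (anti : J₂ * J₁ = -(J₁ * J₂)) {p q r : ℝ} {x : V} (hx : Jv J₁ J₂ p q r x = 0) :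
    x = 0 ∨ (p = 0 ∧ q = 0 ∧ r = 0) := by
  by_cases h : p*p+q*q+r*r = 0
  · right; refine ⟨?_, ?_, ?_⟩ <;> nlinarith [sq_nonneg p, sq_nonneg q, sq_nonneg r]
  · left
    have := congrArg (fun f : Module.End ℝ V => f x) (Jv_mul sq1 sq2 anti p q r p q r)
    have e : Jv J₁ J₂ (q*r-r*q) (r*p-p*r) (p*q-q*p) = 0 := by
      simp [Jv, mul_comm]
    rw [e] at this
    simp only [Module.End.mul_apply, hx, map_zero, add_zero, LinearMap.smul_apply,
      Module.End.one_apply] at this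
    exact (smul_eq_zero.1 this.symm).resolve_left (neg_ne_zero.2 h)

lemma Jv_zero [Nontrivial V] {J₁ J₂ : Module.End ℝ V} (sq1 : J₁ * J₁ = -1) (sq2 : J₂ * J₂ = -1)
    (anti : J₂ * J₁ = -(J₁ * J₂)) {p q r : ℝ} (hx : Jv J₁ J₂ p q r = 0) :
    p = 0 ∧ q = 0 ∧ r = 0 := by
  obtain ⟨x, hx0⟩ := exists_ne (0 : V)
  exact (Jv_inj sq1 sq2 anti (x := x) (by rw [hx]; rfl)).resolve_left hx0

variable {J₁ J₂ : Module.End ℝ V} {ω : V →ₗ[ℝ] V →ₗ[ℝ] ℝ}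
    {ρ : L →ₗ[ℝ] Module.End ℝ V} {β : V → V → L}

lemma QS.one_zero [Nontrivial V] (h : QS J₁ J₂ ω ρ β) {s p q r : ℝ}
    (hx : s • (1 : Module.End ℝ V) + Jv J₁ J₂ p q r = 0) : s = 0 := by
  have h1 : Jv J₁ J₂ p q r = (-s) • (1 : Module.End ℝ V) := by
    rw [eq_comm, ← sub_eq_zero, ← neg_eq_zero, ← hx]; module
  have h2 := Jv_mul h.sq1 h.sq2 h.anti p q r p q r
  have e : Jv J₁ J₂ (q*r-r*q) (r*p-p*r) (p*q-q*p) = 0 := by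
      simp [Jv, mul_comm]
  rw [e, add_zero, h1, smul_mul_smul_comm, one_mul] at h2
  have h3 : (-s * -s + (p*p+q*q+r*r)) • (1 : Module.End ℝ V) = 0 := by
    rw [add_smul, h2]; module
  have := (smul_eq_zero.1 h3).resolve_right one_ne_zero
  nlinarith [sq_nonneg p, sq_nonneg q, sq_nonneg r]

/-- the action of `a` on `Q` is a cross product -/
lemma QS.cross [Nontrivial V] (h : QS J₁ J₂ ω ρ β) (a : L) : ∃ p q r : ℝ, ∀ x y z : ℝ,
    ρ a * Jv J₁ J₂ x y z - Jv J₁ J₂ x y z * ρ a =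
      Jv J₁ J₂ (q*z-r*y) (r*x-p*z) (p*y-q*x) := by
  obtain ⟨c, d, e, h1⟩ := h.Q1 a
  obtain ⟨c', d', e', h2⟩ := h.Q2 a
  have e1 : J₁ = Jv J₁ J₂ 1 0 0 := by simp [Jv]
  have e2 : J₂ = Jv J₁ J₂ 0 1 0 := by simp [Jv]
  have hm := Jv_mul h.sq1 h.sq2 h.anti
  have k1 : (ρ a * J₁ - J₁ * ρ a) * J₁ + J₁ * (ρ a * J₁ - J₁ * ρ a) = 0 := by
    have : (ρ a * J₁ - J₁ * ρ a) * J₁ + J₁ * (ρ a * J₁ - J₁ * ρ a) =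
      ρ a * (J₁ * J₁) - (J₁ * J₁) * ρ a := by noncomm_ring
    rw [this, h.sq1]; simp
  have k2 : (ρ a * J₂ - J₂ * ρ a) * J₂ + J₂ * (ρ a * J₂ - J₂ * ρ a) = 0 := by
    have : (ρ a * J₂ - J₂ * ρ a) * J₂ + J₂ * (ρ a * J₂ - J₂ * ρ a) =
      ρ a * (J₂ * J₂) - (J₂ * J₂) * ρ a := by noncomm_ring
    rw [this, h.sq2]; simp
  have k3 : (ρ a * J₁ - J₁ * ρ a) * J₂ + J₁ * (ρ a * J₂ - J₂ * ρ a) +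
      ((ρ a * J₂ - J₂ * ρ a) * J₁ + J₂ * (ρ a * J₁ - J₁ * ρ a)) = 0 := by
    have : (ρ a * J₁ - J₁ * ρ a) * J₂ + J₁ * (ρ a * J₂ - J₂ * ρ a) +
      ((ρ a * J₂ - J₂ * ρ a) * J₁ + J₂ * (ρ a * J₁ - J₁ * ρ a)) =
      ρ a * (J₁ * J₂ + J₂ * J₁) - (J₁ * J₂ + J₂ * J₁) * ρ a := by noncomm_ring
    rw [this, h.anti]; simp
  have f1 : c • J₁ + d • J₂ + e • (J₁ * J₂) = Jv J₁ J₂ c d e := rfl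
  have f2 : c' • J₁ + d' • J₂ + e' • (J₁ * J₂) = Jv J₁ J₂ c' d' e' := rfl
  rw [f1] at h1
  rw [f2] at h2
  rw [h1] at k1 k3
  rw [h2] at k2 k3
  have l1 : Jv J₁ J₂ c d e * Jv J₁ J₂ 1 0 0 + Jv J₁ J₂ 1 0 0 * Jv J₁ J₂ c d e = 0 := by
    rw [← e1]; exact k1
  have l2 : Jv J₁ J₂ c' d' e' * Jv J₁ J₂ 0 1 0 + Jv J₁ J₂ 0 1 0 * Jv J₁ J₂ c' d' e' = 0 := by
    rw [← e2]; exact k2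
  have l3 : Jv J₁ J₂ c d e * Jv J₁ J₂ 0 1 0 + Jv J₁ J₂ 1 0 0 * Jv J₁ J₂ c' d' e' +
      (Jv J₁ J₂ c' d' e' * Jv J₁ J₂ 1 0 0 + Jv J₁ J₂ 0 1 0 * Jv J₁ J₂ c d e) = 0 := by
    rw [← e1, ← e2]; exact k3
  rw [hm, hm] at l1 l2
  rw [hm, hm, hm, hm] at l3
  have m1 : (-2*c) • (1 : Module.End ℝ V) + Jv J₁ J₂ 0 0 0 = 0 := by
    rw [← l1]; simp only [Jv]; module
  have m2 : (-2*d') • (1 : Module.End ℝ V) + Jv J₁ J₂ 0 0 0 = 0 := by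
    rw [← l2]; simp only [Jv]; module
  have m3 : (-2*d-2*c') • (1 : Module.End ℝ V) + Jv J₁ J₂ 0 0 0 = 0 := by
    rw [← l3]; simp only [Jv]; module
  have n1 := h.one_zero m1
  have n2 := h.one_zero m2
  have n3 := h.one_zero m3
  have o1 : c = 0 := by linarith
  have o2 : d' = 0 := by linarith
  have o3 : c' = -d := by linarith
  subst o1 o2 o3
  refine ⟨e', -e, d, fun x y z => ?_⟩
  have : ρ a * Jv J₁ J₂ x y z - Jv J₁ J₂ x y z * ρ a =
    x • (ρ a * J₁ - J₁ * ρ a) + y • (ρ a * J₂ - J₂ * ρ a) +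
    z • ((ρ a * J₁ - J₁ * ρ a) * J₂ + J₁ * (ρ a * J₂ - J₂ * ρ a)) := by
    simp only [Jv, mul_add, add_mul, mul_smul_comm, smul_mul_assoc, mul_sub, sub_mul, mul_assoc]
    module
  have l4 : Jv J₁ J₂ 0 d e * J₂ + J₁ * Jv J₁ J₂ (-d) 0 e' = 
    Jv J₁ J₂ 0 d e * Jv J₁ J₂ 0 1 0 + Jv J₁ J₂ 1 0 0 * Jv J₁ J₂ (-d) 0 e' := by
    rw [← e1, ← e2]
  rw [this, h1, h2, l4, hm, hm]
  simp only [Jv]; module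

lemma QS.skewJ1 (h : QS J₁ J₂ ω ρ β) (x y : V) : ω (J₁ x) y = - ω x (J₁ y) := by
  have := h.herm1 x (J₁ y)
  have e : J₁ (J₁ y) = -y := congrArg (fun f : Module.End ℝ V => f y) h.sq1
  rw [e] at this; simp at this; linarith

lemma QS.skewJ2 (h : QS J₁ J₂ ω ρ β) (x y : V) : ω (J₂ x) y = - ω x (J₂ y) := by
  have := h.herm2 x (J₂ y)
  have e : J₂ (J₂ y) = -y := congrArg (fun f : Module.End ℝ V => f y) h.sq2
  rw [e] at this; simp at this; linarith

/-- pair symmetry -/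
lemma pair_symm {U : Submodule ℝ V} (K : V → V → V → V → ℝ)
    (h1 : ∀ x ∈ U, ∀ y ∈ U, ∀ z ∈ U, ∀ w ∈ U, K x y z w = -K y x z w)
    (h2 : ∀ x ∈ U, ∀ y ∈ U, ∀ z ∈ U, ∀ w ∈ U, K x y z w = -K x y w z)
    (h3 : ∀ x ∈ U, ∀ y ∈ U, ∀ z ∈ U, ∀ w ∈ U, K x y z w + K y z x w + K z x y w = 0) :
    ∀ x ∈ U, ∀ y ∈ U, ∀ z ∈ U, ∀ w ∈ U, K x y z w = K z w x y := by
  intro x hx y hy z hz w hw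
  have a1 := h3 x hx y hy z hz w hw
  have a2 := h3 y hy z hz w hw x hx
  have a3 := h3 z hz w hw x hx y hy
  have a4 := h3 w hw x hx y hy z hz
  have b1 := h2 y hy z hz x hx w hw
  have b2 := h2 z hz x hx y hy w hw
  have b3 := h2 w hw y hy z hz x hx
  have b4 := h2 w hw x hx z hz y hy
  have b5 := h2 x hx y hy z hz w hw
  have b6 := h2 z hz w hw y hy x hx
  have c1 := h1 x hx z hz w hw y hy
  have c2 := h1 y hy w hw x hx z hz
  have c4 := h2 z hz x hx w hw y hy
  have c5 := h2 y hy w hw x hx z hz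
  have c6 := h1 w hw y hy z hz x hx
  linarith

lemma flat (h : QS J₁ J₂ ω ρ β) {VA VB : Submodule ℝ V} {LA : Set L} (hA : Half ω ρ β VA VB LA)
    (orth : ∀ x ∈ VA, ∀ y ∈ VB, ω y x = 0) (hsup : VA ⊔ VB = ⊤)
    (hJ1 : ∀ x ∈ VA, J₁ x ∈ VA) (hJ2 : ∀ x ∈ VA, J₂ x ∈ VA)
    (hc1 : ∀ a ∈ LA, ∀ x, ρ a (J₁ x) = J₁ (ρ a x)) (hc2 : ∀ a ∈ LA, ∀ x, ρ a (J₂ x) = J₂ (ρ a x)) :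
    VA = ⊥ := by
  have nd : ∀ z ∈ VA, (∀ y ∈ VA, ω y z = 0) → z = 0 := by
    intro z hz hy
    apply h.nd
    intro x
    have : x ∈ VA ⊔ VB := hsup ▸ Submodule.mem_top
    obtain ⟨x1, h1, x2, h2, rfl⟩ := Submodule.mem_sup.1 this
    simp [hy x1 h1, orth z hz x2 h2]
  have s1 : ∀ x y z w, ω (ρ (β x y) z) w = - ω (ρ (β y x) z) w := by
    intro x y z w; rw [h.skew x y]; simp
  have s2 : ∀ x y z w, ω (ρ (β x y) z) w = ω (ρ (β x y) w) z := by
    intro x y z w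
    have := h.inv (β x y) z w
    rw [h.alt z] at this; linarith
  have s3 : ∀ x y z w, ω (ρ (β x y) z) w + ω (ρ (β y z) x) w + ω (ρ (β z x) y) w = 0 := by
    intro x y z w
    have := congrArg (fun v => ω v w) (h.jac x y z)
    simpa using this
  have p1 := pair_symm (U := VA) (fun x y z w => ω (ρ (β x y) z) (J₁ w))
    (fun x hx y hy z hz w hw => s1 _ _ _ _)
    (fun x hx y hy z hz w hw => by
      show ω (ρ (β x y) z) (J₁ w) = - ω (ρ (β x y) w) (J₁ z)
      rw [s2, hc1 _ (hA.br x hx y hy), h.skewJ1])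
    (fun x hx y hy z hz w hw => s3 _ _ _ _)
  have p2 := pair_symm (U := VA) (fun x y z w => ω (ρ (β x y) z) (J₂ w))
    (fun x hx y hy z hz w hw => s1 _ _ _ _)
    (fun x hx y hy z hz w hw => by
      show ω (ρ (β x y) z) (J₂ w) = - ω (ρ (β x y) w) (J₂ z)
      rw [s2, hc2 _ (hA.br x hx y hy), h.skewJ2])
    (fun x hx y hy z hz w hw => s3 _ _ _ _)
  beta_reduce at p1 p2
  have an : ∀ x, J₂ (J₁ x) = - J₁ (J₂ x) := fun x =>
    congrArg (fun f : Module.End ℝ V => f x) h.anti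
  have q22 : ∀ x, J₂ (J₂ x) = - x := fun x =>
    congrArg (fun f : Module.End ℝ V => f x) h.sq2
  have fl : ∀ x ∈ VA, ∀ y ∈ VA, ∀ z ∈ VA, ∀ w ∈ VA, ω (ρ (β x y) z) (J₁ w) = 0 := by
    intro x hx y hy z hz w hw
    -- R(J₂x, J₂y) = R(x,y) by p2
    have e1 : ω (ρ (β (J₂ x) (J₂ y)) z) (J₂ (J₂ (J₁ w))) = ω (ρ (β x y) z) (J₂ (J₂ (J₁ w))) := by
      rw [p2 _ (hJ2 _ hx) _ (hJ2 _ hy) _ hz _ (hJ2 _ (hJ1 _ hw)),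
        p2 _ hx _ hy _ hz _ (hJ2 _ (hJ1 _ hw)),
        hc2 _ (hA.br _ hz _ (hJ2 _ (hJ1 _ hw))), h.herm2]
    have e2 : ω (ρ (β (J₂ x) (J₂ y)) z) (J₁ w) = - ω (ρ (β x y) z) (J₁ w) := by
      rw [p1 _ (hJ2 _ hx) _ (hJ2 _ hy) _ hz _ hw,
        p1 _ hx _ hy _ hz _ hw,
        hc2 _ (hA.br _ hz _ hw), ← h.herm2 _ (J₁ y), an]
      simp
    rw [q22] at e1
    simp only [map_neg] at e1
    linarith
  rw [eq_bot_iff]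
  intro z hz
  have q11 : ∀ x, J₁ (J₁ x) = - x := fun x =>
    congrArg (fun f : Module.End ℝ V => f x) h.sq1
  have f0 : ∀ u ∈ VA, ∀ v ∈ VA, ρ (β u v) z = 0 := by
    intro u hu v hv
    refine nd _ (hA.maps _ (hA.br _ hu _ hv) _) fun y hy => ?_
    have := fl u hu v hv z hz (J₁ y) (hJ1 _ hy)
    rw [q11] at this
    rw [h.alt]; simp at this; simp [this]
  exact nd z hz (hA.key z (hA.gen z hz f0))


lemma half_orth (h : QS J₁ J₂ ω ρ β) {VA VB : Submodule ℝ V} {LA : Set L}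
    (hA : Half ω ρ β VA VB LA) : ∀ x ∈ VA, ∀ y ∈ VB, ω y x = 0 := by
  intro x hx y hy
  rw [h.alt, hA.key y (fun a ha => hA.kill a ha y hy) x hx, neg_zero]

lemma half_nd (h : QS J₁ J₂ ω ρ β) {VA VB : Submodule ℝ V} {LA : Set L}
    (hA : Half ω ρ β VA VB LA) (hsup : VA ⊔ VB = ⊤) :
    ∀ z ∈ VA, (∀ y ∈ VA, ω y z = 0) → z = 0 := by
  intro z hz hy
  apply h.nd
  intro x
  have : x ∈ VA ⊔ VB := hsup ▸ Submodule.mem_top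
  obtain ⟨x1, h1, x2, h2, rfl⟩ := Submodule.mem_sup.1 this
  simp [hy x1 h1, half_orth h hA z hz x2 h2]

lemma half_inv (h : QS J₁ J₂ ω ρ β) {VA VB : Submodule ℝ V} {LA : Set L}
    (hA : Half ω ρ β VA VB LA) (hsup : VA ⊔ VB = ⊤) :
    ∀ z ∈ VA, (∀ a ∈ LA, ρ a z = 0) → z = 0 :=
  fun z hz hy => half_nd h hA hsup z hz (hA.key z hy)

lemma stableB (h : QS J₁ J₂ ω ρ β) {VA VB : Submodule ℝ V} {LA : Set L}
    (hA : Half ω ρ β VA VB LA) (hsup : VA ⊔ VB = ⊤) (J : Module.End ℝ V)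
    (hc : ∀ a ∈ LA, ∀ x, ρ a (J x) = J (ρ a x)) : ∀ x ∈ VB, J x ∈ VB := by
  intro x hx
  have : J x ∈ VA ⊔ VB := hsup ▸ Submodule.mem_top
  obtain ⟨u, hu, v, hv, e⟩ := Submodule.mem_sup.1 this
  have : u = 0 := by
    refine half_inv h hA hsup u hu fun a ha => ?_
    have h1 := hc a ha x
    rw [hA.kill a ha x hx, ← e, map_add, hA.kill a ha v hv] at h1
    simpa using h1
  rw [← e, this, zero_add]; exact hv

lemma stableA (h : QS J₁ J₂ ω ρ β) {VA VB : Submodule ℝ V} {LA LB : Set L}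
    (hA : Half ω ρ β VA VB LA) (hB : Half ω ρ β VB VA LB) (hsup : VA ⊔ VB = ⊤)
    (J : Module.End ℝ V)
    (hs : ∀ x y, ω (J x) y = - ω x (J y)) (hJ : ∀ x ∈ VB, J x ∈ VB) : ∀ x ∈ VA, J x ∈ VA := by
  intro x hx
  have : J x ∈ VA ⊔ VB := hsup ▸ Submodule.mem_top
  obtain ⟨u, hu, v, hv, e⟩ := Submodule.mem_sup.1 this
  have : v = 0 := by
    refine half_nd h hB (by rwa [sup_comm]) v hv fun y hy => ?_
    have h1 := hs y x
    rw [half_orth h hA x hx _ (hJ y hy), ← e, map_add, half_orth h hA u hu y hy] at h1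
    simpa using h1
  rw [← e, this, add_zero]; exact hu

lemma exists_ne_cross [Nontrivial V] (h : QS J₁ J₂ ω ρ β) {VA VB : Submodule ℝ V} {LA LB : Set L}
    (hA : Half ω ρ β VA VB LA) (hB : Half ω ρ β VB VA LB) (hsup : VA ⊔ VB = ⊤) (hne : VA ≠ ⊥) :
    ∃ a ∈ LA, ∃ p q r : ℝ, p*p+q*q+r*r ≠ 0 ∧ ∀ x y z : ℝ,
    ρ a * Jv J₁ J₂ x y z - Jv J₁ J₂ x y z * ρ a =
      Jv J₁ J₂ (q*z-r*y) (r*x-p*z) (p*y-q*x) := by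
  by_contra hcon
  push Not at hcon
  have comm : ∀ a ∈ LA, ∀ x y z : ℝ, ∀ v, ρ a (Jv J₁ J₂ x y z v) = Jv J₁ J₂ x y z (ρ a v) := by
    intro a ha x y z v
    obtain ⟨p, q, r, hp⟩ := h.cross a
    have h0 : p*p+q*q+r*r = 0 := by
      by_contra h0
      obtain ⟨x, y, z, hh⟩ := hcon a ha p q r h0
      exact hh (hp x y z)
    have hp0 : p = 0 := by nlinarith [sq_nonneg p, sq_nonneg q, sq_nonneg r]
    have hq0 : q = 0 := by nlinarith [sq_nonneg p, sq_nonneg q, sq_nonneg r]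
    have hr0 : r = 0 := by nlinarith [sq_nonneg p, sq_nonneg q, sq_nonneg r]
    have := congrArg (fun f : Module.End ℝ V => f v) (hp x y z)
    subst hp0 hq0 hr0
    simp only [LinearMap.sub_apply, Module.End.mul_apply] at this
    rw [← sub_eq_zero, this]
    simp [Jv]
  have e1 : J₁ = Jv J₁ J₂ 1 0 0 := by simp [Jv]
  have e2 : J₂ = Jv J₁ J₂ 0 1 0 := by simp [Jv]
  have c1 : ∀ a ∈ LA, ∀ x, ρ a (J₁ x) = J₁ (ρ a x) := by
    intro a ha v; have := comm a ha 1 0 0 v; rwa [← e1] at this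
  have c2 : ∀ a ∈ LA, ∀ x, ρ a (J₂ x) = J₂ (ρ a x) := by
    intro a ha v; have := comm a ha 0 1 0 v; rwa [← e2] at this
  exact hne (flat h hA (half_orth h hA) hsup
    (stableA h hA hB hsup J₁ h.skewJ1 (stableB h hA hsup J₁ c1))
    (stableA h hA hB hsup J₂ h.skewJ2 (stableB h hA hsup J₂ c2)) c1 c2)

lemma swap_maps {VA VB : Submodule ℝ V} {LA : Set L}
    (hA : Half ω ρ β VA VB LA) {a : L} (ha : a ∈ LA) {p q r : ℝ} (hn : p*p+q*q+r*r ≠ 0)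
    (hc : ∀ x y z : ℝ, ρ a * Jv J₁ J₂ x y z - Jv J₁ J₂ x y z * ρ a =
      Jv J₁ J₂ (q*z-r*y) (r*x-p*z) (p*y-q*x)) {x y z : ℝ} (hxyz : p*x+q*y+r*z = 0) :
    ∀ v ∈ VB, Jv J₁ J₂ x y z v ∈ VA := by
  intro v hv
  set n := p*p+q*q+r*r with hnn
  have h1 := hc ((y*r-z*q)/n) ((z*p-x*r)/n) ((x*q-y*p)/n)
  have e1 : q*((x*q-y*p)/n) - r*((z*p-x*r)/n) = x := by
    field_simp
    linear_combination (-p)*hxyz - x*hnn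
  have e2 : r*((y*r-z*q)/n) - p*((x*q-y*p)/n) = y := by
    field_simp
    linear_combination (-q)*hxyz - y*hnn
  have e3 : p*((z*p-x*r)/n) - q*((y*r-z*q)/n) = z := by
    field_simp
    linear_combination (-r)*hxyz - z*hnn
  rw [e1, e2, e3] at h1
  rw [← h1]
  simp only [LinearMap.sub_apply, Module.End.mul_apply, hA.kill a ha v hv, map_zero, sub_zero]
  exact hA.maps a ha _

lemma exists_perp (p q r : ℝ) : ∃ x y z : ℝ, x*x+y*y+z*z ≠ 0 ∧ p*x+q*y+r*z = 0 := by
  by_cases h : p = 0 ∧ q = 0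
  · exact ⟨1, 0, 0, by norm_num, by simp [h.1]⟩
  · refine ⟨q, -p, 0, fun h0 => h ⟨?_, ?_⟩, by ring⟩ <;> nlinarith [sq_nonneg p, sq_nonneg q]

lemma finrank_half [Nontrivial V] [FiniteDimensional ℝ V] (h : QS J₁ J₂ ω ρ β)
    {VA VB : Submodule ℝ V} {LA LB : Set L}
    (hA : Half ω ρ β VA VB LA) (hB : Half ω ρ β VB VA LB) (hsup : VA ⊔ VB = ⊤) (hneA : VA ≠ ⊥)
    (hneB : VB ≠ ⊥) : Module.finrank ℝ VA ≤ 2 := by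
  have hsup' : VB ⊔ VA = ⊤ := by rwa [sup_comm]
  obtain ⟨a₀, ha₀, p₀, q₀, r₀, hn₀, hc₀⟩ := exists_ne_cross h hA hB hsup hneA
  obtain ⟨b, hb, p, q, r, hn, hc⟩ := exists_ne_cross h hB hA hsup' hneB
  have hm := Jv_mul h.sq1 h.sq2 h.anti
  -- commuting
  have hcomm : ∀ a ∈ LA, ρ a * ρ b = ρ b * ρ a := by
    intro a ha
    ext v
    have : v ∈ VA ⊔ VB := hsup ▸ Submodule.mem_top
    obtain ⟨v1, h1, v2, h2, rfl⟩ := Submodule.mem_sup.1 this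
    simp only [Module.End.mul_apply, map_add, hA.kill a ha v2 h2, hB.kill b hb v1 h1,
      hA.kill a ha _ (hB.maps b hb _), hB.kill b hb _ (hA.maps a ha _), map_zero]
  have par : ∀ a ∈ LA, ∀ p' q' r' : ℝ, (∀ x y z : ℝ, ρ a * Jv J₁ J₂ x y z - Jv J₁ J₂ x y z * ρ a =
      Jv J₁ J₂ (q'*z-r'*y) (r'*x-p'*z) (p'*y-q'*x)) →
      ∃ l : ℝ, p' = l * p ∧ q' = l * q ∧ r' = l * r := by
    intro a ha p' q' r' hc'
    have key : ∀ x y z : ℝ,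
      Jv J₁ J₂ (q'*(p*y-q*x)-r'*(r*x-p*z)) (r'*(q*z-r*y)-p'*(p*y-q*x)) (p'*(r*x-p*z)-q'*(q*z-r*y))
      = Jv J₁ J₂ (q*(p'*y-q'*x)-r*(r'*x-p'*z)) (r*(q'*z-r'*y)-p*(p'*y-q'*x))
        (p*(r'*x-p'*z)-q*(q'*z-r'*y)) := by
      intro x y z
      rw [← hc', ← hc, ← hc, ← hc']
      have e := hcomm a ha
      generalize Jv J₁ J₂ x y z = T
      have : ρ a * (ρ b * T - T * ρ b) - (ρ b * T - T * ρ b) * ρ a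
        - (ρ b * (ρ a * T - T * ρ a) - (ρ a * T - T * ρ a) * ρ b)
        = (ρ a * ρ b - ρ b * ρ a) * T - T * (ρ a * ρ b - ρ b * ρ a) := by noncomm_ring
      rw [← sub_eq_zero, this, e]; simp
    have z1 := fun x y z => Jv_zero (p := (q'*(p*y-q*x)-r'*(r*x-p*z)) - (q*(p'*y-q'*x)-r*(r'*x-p'*z)))
      (q := (r'*(q*z-r*y)-p'*(p*y-q*x)) - (r*(q'*z-r'*y)-p*(p'*y-q'*x)))
      (r := (p'*(r*x-p*z)-q'*(q*z-r*y)) - (p*(r'*x-p'*z)-q*(q'*z-r'*y)))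
      h.sq1 h.sq2 h.anti (by
        rw [← sub_eq_zero.2 (key x y z)]; simp only [Jv]; module)
    have c1 := z1 1 0 0
    have c2 := z1 0 1 0
    have d1 : p' * q = q' * p := by linarith [c1.2.1]
    have d2 : p' * r = r' * p := by linarith [c1.2.2]
    have d3 : q' * r = r' * q := by linarith [c2.2.2]
    refine ⟨(p'*p+q'*q+r'*r)/(p*p+q*q+r*r), ?_, ?_, ?_⟩ <;> rw [div_mul_eq_mul_div, eq_div_iff hn]
    · linear_combination q * d1 + r * d2
    · linear_combination (-p) * d1 + r * d3
    · linear_combination (-p) * d2 - q * d3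
  obtain ⟨x, y, z, hxn, hperp⟩ := exists_perp p q r
  obtain ⟨l₀, hl1, hl2, hl3⟩ := par a₀ ha₀ _ _ _ hc₀
  have TB : ∀ v ∈ VB, Jv J₁ J₂ x y z v ∈ VA := swap_maps hA ha₀ hn₀ hc₀ (by
    rw [hl1, hl2, hl3]; linear_combination l₀ * hperp)
  have TA : ∀ v ∈ VA, Jv J₁ J₂ x y z v ∈ VB := swap_maps hB hb hn hc hperp
  set T := Jv J₁ J₂ x y z with hT
  have TT : ∀ v, T (T v) = -(x*x+y*y+z*z) • v := by
    intro v
    have := congrArg (fun f : Module.End ℝ V => f v) (hm x y z x y z)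
    have e : Jv J₁ J₂ (y*z-z*y) (z*x-x*z) (x*y-y*x) = 0 := by simp [Jv, mul_comm]
    rw [e] at this
    simpa using this
  set K : Module.End ℝ V := Jv J₁ J₂ (q*z-r*y) (r*x-p*z) (p*y-q*x) * T with hK
  have Kinj : ∀ v, K v = 0 → v = 0 := by
    intro v hv
    rw [hK, Module.End.mul_apply] at hv
    rcases Jv_inj h.sq1 h.sq2 h.anti hv with h1 | ⟨h1, h2, h3⟩
    · rcases Jv_inj h.sq1 h.sq2 h.anti h1 with h1 | ⟨h1, h2, h3⟩
      · exact h1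
      · exact absurd (by rw [h1, h2, h3]; ring) hxn
    · exfalso
      have : (p*p+q*q+r*r)*(x*x+y*y+z*z) = 0 := by
        linear_combination (p*x+q*y+r*z)*hperp + (q*z-r*y)*h1+(r*x-p*z)*h2+(p*y-q*x)*h3
      exact (mul_ne_zero hn hxn) this
  have act : ∀ a ∈ LA, ∃ l : ℝ, ∀ v ∈ VA, ρ a v = l • K v := by
    intro a ha
    obtain ⟨p', q', r', hc'⟩ := h.cross a
    obtain ⟨l, h1, h2, h3⟩ := par a ha _ _ _ hc'
    refine ⟨-l/(x*x+y*y+z*z), fun v hv => ?_⟩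
    have e := congrArg (fun f : Module.End ℝ V => f (T v)) (hc' x y z)
    simp only [LinearMap.sub_apply, Module.End.mul_apply, hA.kill a ha _ (TA v hv), map_zero,
      sub_zero, ← hT, TT] at e
    have e2 : Jv J₁ J₂ (q'*z-r'*y) (r'*x-p'*z) (p'*y-q'*x) =
        l • Jv J₁ J₂ (q*z-r*y) (r*x-p*z) (p*y-q*x) := by
      rw [h1, h2, h3]; simp only [Jv]; module
    rw [e2] at e
    rw [map_smul] at e
    have e3 : ρ a v = (-(x*x+y*y+z*z))⁻¹ • (-(x*x+y*y+z*z)) • ρ a v := by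
      rw [smul_smul, inv_mul_cancel₀ (neg_ne_zero.2 hxn), one_smul]
    rw [e3, e, LinearMap.smul_apply, smul_smul, hK, Module.End.mul_apply]
    congr 1
    field_simp
  choose! l hl using act
  -- nonvanishing
  have : ∃ u ∈ VA, ∃ v ∈ VA, l (β u v) ≠ 0 := by
    by_contra hcon
    push Not at hcon
    apply hneA
    rw [eq_bot_iff]
    intro w hw
    refine half_inv h hA hsup w hw (hA.gen w hw fun u hu v hv => ?_)
    rw [hl _ (hA.br _ hu _ hv) _ hw, hcon u hu v hv, zero_smul]
  obtain ⟨u, hu, v, hv, huv⟩ := this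
  have hle : VA ≤ Submodule.span ℝ (Set.range ![u, v]) := by
    intro w hw
    have hj := h.jac u v w
    rw [hl _ (hA.br _ hu _ hv) _ hw, hl _ (hA.br _ hv _ hw) _ hu, hl _ (hA.br _ hw _ hu) _ hv,
      ← map_smul, ← map_smul, ← map_smul, ← map_add, ← map_add] at hj
    have hj := Kinj _ hj
    have : w = (-(l (β v w)) / l (β u v)) • u + (-(l (β w u)) / l (β u v)) • v := by
      have e : w = (l (β u v))⁻¹ • (l (β u v) • w + l (β v w) • u + l (β w u) • v)
         + (-(l (β v w)) / l (β u v)) • u + (-(l (β w u)) / l (β u v)) • v := by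
        match_scalars <;> field_simp <;> ring
      rw [hj] at e
      simpa using e
    rw [this]
    refine add_mem (Submodule.smul_mem _ _ (Submodule.subset_span ⟨0, rfl⟩))
      (Submodule.smul_mem _ _ (Submodule.subset_span ⟨1, rfl⟩))
  exact (Submodule.finrank_mono hle).trans (finrank_range_le_card _)

lemma finrank_case1 [Nontrivial V] [FiniteDimensional ℝ V] (h : QS J₁ J₂ ω ρ β)
    {VA VB : Submodule ℝ V} {LA LB : Set L}
    (hA : Half ω ρ β VA VB LA) (hB : Half ω ρ β VB VA LB) (hsup : VA ⊔ VB = ⊤) (hneA : VA ≠ ⊥)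
    (hneB : VB ≠ ⊥) : Module.finrank ℝ V ≤ 4 := by
  have h1 := finrank_half h hA hB hsup hneA hneB
  have h2 := finrank_half h hB hA (by rwa [sup_comm]) hneB hneA
  have h3 := Submodule.finrank_add_le_finrank_add_finrank VA VB
  rw [hsup, finrank_top] at h3
  omega

lemma comm_gen {W : Type*} [AddCommGroup W] [Module ℝ W] (rt rs K K₁ K₂ : Module.End ℝ W)
    (k1 : rs * K₁ = K₁ * rs) (k2 : rs * K₂ = K₂ * rs) (hK : rs * K = K * rs)
    (h : ∃ c d e : ℝ, rt * K - K * rt = c • K₁ + d • K₂ + e • (K₁ * K₂)) :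
    ((2 : ℝ) • (rt * rs - rs * rt)) * K - K * ((2 : ℝ) • (rt * rs - rs * rt)) = 0 := by
  obtain ⟨c, d, e, h⟩ := h
  have hT : rs * (rt * K - K * rt) = (rt * K - K * rt) * rs := by
    rw [h]
    simp only [mul_add, add_mul, mul_smul_comm, smul_mul_assoc, k1, k2]
    rw [← mul_assoc, k1, mul_assoc, k2, mul_assoc]
  have : (rt * rs - rs * rt) * K - K * (rt * rs - rs * rt) =
    rt * (rs * K - K * rs) - (rs * K - K * rs) * rt -
    (rs * (rt * K - K * rt) - (rt * K - K * rt) * rs) := by noncomm_ring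
  rw [hT, hK, sub_self, sub_self, mul_zero, zero_mul, sub_self, sub_self, sub_eq_zero] at this
  rw [sub_eq_zero, smul_mul_assoc, this]
  exact (mul_smul_comm _ _ _).symm

lemma pair_eq {W : Type*} [AddCommGroup W] [Module ℝ W] (K₁ K₂ : Module.End ℝ W) (p q r : ℝ) :
    (Jv K₁ K₂ (q*0-r*0) (r*1-p*0) (p*0-q*1), Jv K₁ K₂ (q*0-r*1) (r*0-p*0) (p*1-q*0)) =
      p • ((0 : Module.End ℝ W), K₁ * K₂) + q • (-(K₁ * K₂), (0 : Module.End ℝ W))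
        + r • (K₂, -K₁) := by
  ext1
  · simp only [Jv, Prod.fst_add, Prod.smul_fst]; module
  · simp only [Jv, Prod.snd_add, Prod.smul_snd]; module

end helper

section lie
variable {𝔤 : Type*} [LieRing 𝔤] [LieAlgebra ℝ 𝔤] [LieAlgebra.IsSemisimple ℝ 𝔤]

lemma exists_compl_max (A : LieIdeal ℝ 𝔤) : ∃ B : LieIdeal ℝ 𝔤, A ⊓ B = ⊥ ∧ A ⊔ B = ⊤ ∧
    ∀ D : LieIdeal ℝ 𝔤, A ⊓ D = ⊥ → D ≤ B := by
  refine ⟨Aᶜ, ?_, ?_, ?_⟩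
  · exact inf_compl_eq_bot
  · exact sup_compl_eq_top
  · intro D hD
    exact le_compl_iff_disjoint_left.2 (disjoint_iff.2 hD)

lemma perfect_ideal (A : LieIdeal ℝ 𝔤) : ⁅A, A⁆ = A := by
  obtain ⟨B, h1, h2, -⟩ := exists_compl_max ⁅A, A⁆
  have hle : ⁅A, A⁆ ≤ A := LieSubmodule.lie_le_right _ _
  have hab : A ⊓ B = ⊥ := by
    have : IsLieAbelian (A ⊓ B : LieIdeal ℝ 𝔤) := by
      rw [LieSubmodule.lie_abelian_iff_lie_self_eq_bot, eq_bot_iff, ← h1]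
      exact le_inf (LieSubmodule.mono_lie inf_le_left inf_le_left)
        ((LieSubmodule.lie_le_right _ _).trans inf_le_right)
    exact (LieAlgebra.hasTrivialRadical_iff_no_abelian_ideals ℝ 𝔤).1 inferInstance _ this
  refine le_antisymm hle fun x hx => ?_
  have hx' : x ∈ ⁅A, A⁆ ⊔ B := h2 ▸ LieSubmodule.mem_top _
  obtain ⟨a, ha, b, hb, rfl⟩ := (LieSubmodule.mem_sup _ _ _).1 hx'
  have hbA : b ∈ A ⊓ B := ⟨by simpa using sub_mem hx (hle ha), hb⟩
  rw [hab, LieSubmodule.mem_bot] at hbA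
  rw [hbA, add_zero]; exact ha

end lie


/-- Let `(𝔤, σ, J₁, J₂, ω)` be a quaternionic skew-Hermitian
transvection involutive Lie algebra (qs-H tiLa) whose underlying
finite-dimensional real Lie algebra `𝔤` is semisimple (equivalently, its
Killing form is nondegenerate), and suppose `dim_ℝ 𝔪 > 4`, where
`𝔪 = {x | σ x = -x} = ker (σ + id)`.  Then `𝔤` is simple. -/
theorem qsH_tiLa_semisimple_is_simple
    (𝔤 : Type*) [LieRing 𝔤] [LieAlgebra ℝ 𝔤]
    [FiniteDimensional ℝ 𝔤] [LieAlgebra.IsSemisimple ℝ 𝔤]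
    (σ : 𝔤 →ₗ⁅ℝ⁆ 𝔤) (hσ : ∀ x, σ (σ x) = x)
    (hdim : 4 < Module.finrank ℝ
      ↥(LinearMap.ker (σ.toLinearMap + (LinearMap.id : 𝔤 →ₗ[ℝ] 𝔤))))
    (hlm : ∀ x : 𝔤, σ x = x →
      x ∈ Submodule.span ℝ {z : 𝔤 | ∃ u v : 𝔤, σ u = -u ∧ σ v = -v ∧ z = ⁅u, v⁆})
    (hideal : ∀ I : LieIdeal ℝ 𝔤, (∀ x ∈ I, σ x = x) → I = ⊥)
    (J₁ J₂ : 𝔤 →ₗ[ℝ] 𝔤)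
    (hJ₁m : ∀ x : 𝔤, σ x = -x → σ (J₁ x) = -(J₁ x))
    (hJ₂m : ∀ x : 𝔤, σ x = -x → σ (J₂ x) = -(J₂ x))
    (hJ₁sq : ∀ x : 𝔤, σ x = -x → J₁ (J₁ x) = -x)
    (hJ₂sq : ∀ x : 𝔤, σ x = -x → J₂ (J₂ x) = -x)
    (hanti : ∀ x : 𝔤, σ x = -x → J₁ (J₂ x) = -(J₂ (J₁ x)))
    (ω : 𝔤 →ₗ[ℝ] 𝔤 →ₗ[ℝ] ℝ)
    (hωalt : ∀ x y : 𝔤, σ x = -x → σ y = -y → ω x y = -(ω y x))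
    (hωnd : ∀ z : 𝔤, σ z = -z → (∀ x : 𝔤, σ x = -x → ω x z = 0) → z = 0)
    (hQinv : ∀ a : 𝔤, σ a = a →
      ∀ T ∈ Submodule.span ℝ ({J₁, J₂, J₁ ∘ₗ J₂} : Set (𝔤 →ₗ[ℝ] 𝔤)),
      ∃ S ∈ Submodule.span ℝ ({J₁, J₂, J₁ ∘ₗ J₂} : Set (𝔤 →ₗ[ℝ] 𝔤)),
        ∀ x : 𝔤, σ x = -x → ⁅a, T x⁆ - T ⁅a, x⁆ = S x)
    (hωinv : ∀ a x y : 𝔤, σ a = a → σ x = -x → σ y = -y →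
      ω ⁅a, x⁆ y + ω x ⁅a, y⁆ = 0)
    (hherm₁ : ∀ x y : 𝔤, σ x = -x → σ y = -y → ω (J₁ x) (J₁ y) = ω x y)
    (hherm₂ : ∀ x y : 𝔤, σ x = -x → σ y = -y → ω (J₂ x) (J₂ y) = ω x y) :
    LieAlgebra.IsSimple ℝ 𝔤 := by
  classical
  set V : Submodule ℝ 𝔤 := LinearMap.ker (σ.toLinearMap + (LinearMap.id : 𝔤 →ₗ[ℝ] 𝔤)) with hV
  have memV : ∀ x, x ∈ V ↔ σ x = -x := by
    intro x
    rw [hV, LinearMap.mem_ker, LinearMap.add_apply, LinearMap.id_apply, LieHom.coe_toLinearMap,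
      add_eq_zero_iff_eq_neg]
  have sV : ∀ x : V, σ (x : 𝔤) = -(x : 𝔤) := fun x => (memV _).1 x.2
  let π : 𝔤 →ₗ[ℝ] V := LinearMap.codRestrict V ((1/2 : ℝ) • (LinearMap.id - σ.toLinearMap)) (by
    intro x; rw [memV]; simp [hσ]; module)
  have hπ : ∀ x, (π x : 𝔤) = (1/2 : ℝ) • (x - σ x) := fun x => rfl
  let ρ : 𝔤 →ₗ[ℝ] Module.End ℝ V :=
    { toFun := fun a => π ∘ₗ (LieAlgebra.ad ℝ 𝔤 a : 𝔤 →ₗ[ℝ] 𝔤) ∘ₗ V.subtype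
      map_add' := fun a b => by ext x; simp
      map_smul' := fun c a => by ext x; simp }
  have hρ : ∀ a (x : V), (ρ a x : 𝔤) = (1/2 : ℝ) • (⁅a, (x : 𝔤)⁆ + ⁅σ a, (x : 𝔤)⁆) := by
    intro a x
    show (π ⁅a, (x : 𝔤)⁆ : 𝔤) = _
    rw [hπ, LieHom.map_lie, sV, lie_neg, sub_neg_eq_add]
  have hρ' : ∀ a (x : V), (ρ a x : 𝔤) = ⁅(1/2 : ℝ) • (a + σ a), (x : 𝔤)⁆ := by
    intro a x; rw [hρ, smul_lie, add_lie]
  have hfix : ∀ a, σ ((1/2 : ℝ) • (a + σ a)) = (1/2 : ℝ) • (a + σ a) := by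
    intro a; simp [hσ, add_comm]
  let K₁ : Module.End ℝ V := J₁.restrict (p := V) (q := V) fun x hx =>
    (memV _).2 (hJ₁m x ((memV x).1 hx))
  let K₂ : Module.End ℝ V := J₂.restrict (p := V) (q := V) fun x hx =>
    (memV _).2 (hJ₂m x ((memV x).1 hx))
  have hK₁ : ∀ x : V, (K₁ x : 𝔤) = J₁ x := fun x => rfl
  have hK₂ : ∀ x : V, (K₂ x : 𝔤) = J₂ x := fun x => rfl
  let w : V →ₗ[ℝ] V →ₗ[ℝ] ℝ := ω.domRestrict₁₂ V V
  have hw : ∀ x y : V, w x y = ω x y := fun x y => rfl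
  let β : V → V → 𝔤 := fun x y => ⁅(x : 𝔤), (y : 𝔤)⁆
  have hβfix : ∀ x y : V, σ ⁅(x : 𝔤), (y : 𝔤)⁆ = ⁅(x : 𝔤), (y : 𝔤)⁆ := by
    intro x y; rw [LieHom.map_lie, sV, sV]; simp
  have hρfix : ∀ a, σ a = a → ∀ x : V, (ρ a x : 𝔤) = ⁅a, (x : 𝔤)⁆ := by
    intro a ha x; rw [hρ, ha]; module
  have hspan : ∀ S ∈ Submodule.span ℝ ({J₁, J₂, J₁ ∘ₗ J₂} : Set (𝔤 →ₗ[ℝ] 𝔤)),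
      ∃ c d e : ℝ, S = c • J₁ + d • J₂ + e • (J₁ ∘ₗ J₂) := by
    intro S hS
    obtain ⟨c, d, e, h⟩ := Submodule.mem_span_triple.1 hS
    exact ⟨c, d, e, h.symm⟩
  have qs : QS K₁ K₂ w ρ β := by
    refine ⟨?_, ?_, ?_, ?_, ?_, ?_, ?_, ?_, ?_, ?_, ?_, ?_⟩
    · ext x; simp [hK₁, hJ₁sq _ (sV x)]
    · ext x; simp [hK₂, hJ₂sq _ (sV x)]
    · ext x; simp [hK₁, hK₂, hanti _ (sV x)]
    · intro x y; exact hωalt _ _ (sV x) (sV y)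
    · intro z hz
      exact Subtype.ext (hωnd z (sV z) fun x hx => hz ⟨x, (memV x).2 hx⟩)
    · intro x y; exact hherm₁ _ _ (sV x) (sV y)
    · intro x y; exact hherm₂ _ _ (sV x) (sV y)
    · intro a x y
      rw [hw, hw, hρ', hρ']
      exact hωinv _ _ _ (hfix a) (sV x) (sV y)
    · intro a
      obtain ⟨S, hS, h⟩ := hQinv _ (hfix a) J₁ (Submodule.subset_span (by simp))
      obtain ⟨c, d, e, rfl⟩ := hspan S hS
      refine ⟨c, d, e, ?_⟩
      ext x
      have := h x (sV x)
      simp only [LinearMap.sub_apply, Module.End.mul_apply, Submodule.coe_sub, hρ', hK₁, this]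
      simp [hK₁, hK₂]
    · intro a
      obtain ⟨S, hS, h⟩ := hQinv _ (hfix a) J₂ (Submodule.subset_span (by simp))
      obtain ⟨c, d, e, rfl⟩ := hspan S hS
      refine ⟨c, d, e, ?_⟩
      ext x
      have := h x (sV x)
      simp only [LinearMap.sub_apply, Module.End.mul_apply, Submodule.coe_sub, hρ', hK₂, this]
      simp [hK₁, hK₂]
    · intro x y; exact (lie_skew _ _).symm
    · intro x y z
      apply Subtype.ext
      simp only [Submodule.coe_add, hρfix _ (hβfix _ _), β, Submodule.coe_zero]
      rw [← lie_skew ⁅(x : 𝔤), (y : 𝔤)⁆ (z : 𝔤), ← lie_skew ⁅(y : 𝔤), (z : 𝔤)⁆ (x : 𝔤),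
        ← lie_skew ⁅(z : 𝔤), (x : 𝔤)⁆ (y : 𝔤), ← neg_eq_zero]
      refine Eq.trans ?_ (lie_jacobi (x : 𝔤) (y : 𝔤) (z : 𝔤))
      abel
  have hVnt : Nontrivial V := Module.nontrivial_of_finrank_pos (R := ℝ) (by omega)
  -- key
  have key : ∀ I : LieIdeal ℝ 𝔤, ∀ x : V, (∀ a ∈ I, ρ a x = 0) → ∀ y : V, (y : 𝔤) ∈ I →
      w y x = 0 := by
    intro I x hx y hy
    have hπy : π (y : 𝔤) = y := by
      apply Subtype.ext; rw [hπ, sV]; module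
    rw [← hπy]
    rw [← perfect_ideal I, ← LieSubmodule.mem_toSubmodule,
      LieSubmodule.lieIdeal_oper_eq_linear_span'] at hy
    generalize (y : 𝔤) = g at hy
    induction hy using Submodule.span_induction with
    | mem g hg =>
      obtain ⟨u, hu, v, hv, rfl⟩ := hg
      have : π ⁅u, v⁆ = ρ u (π v) - ρ v (π u) := by
        apply Subtype.ext
        rw [Submodule.coe_sub, hρ, hρ, hπ, hπ, hπ, LieHom.map_lie]
        simp only [lie_smul, lie_sub]
        rw [← lie_skew u v, ← lie_skew (σ u) (σ v), ← lie_skew (σ v) u, ← lie_skew v (σ u)]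
        module
      have i1 := qs.inv u (π v) x
      have i2 := qs.inv v (π u) x
      rw [hx u hu] at i1
      rw [hx v hv] at i2
      rw [this, map_sub, LinearMap.sub_apply]
      simp at i1 i2
      rw [i1, i2, sub_zero]
    | zero => simp
    | add a b _ _ ha hb => simp [ha, hb]
    | smul c a _ ha => simp [ha]
  let W : LieIdeal ℝ 𝔤 → Submodule ℝ V := fun A => A.toSubmodule.comap V.subtype
  have hW : ∀ A (x : V), x ∈ W A ↔ (x : 𝔤) ∈ A := fun A x => Iff.rfl
  have brzero : ∀ A B : LieIdeal ℝ 𝔤, A ⊓ B = ⊥ → ∀ a ∈ A, ∀ b ∈ B, ⁅a, b⁆ = 0 := by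
    intro A B h a ha b hb
    have : ⁅a, b⁆ ∈ A ⊓ B := ⟨lie_mem_left ℝ 𝔤 A a b ha, lie_mem_right ℝ 𝔤 B a b hb⟩
    rw [h] at this
    simpa using this
  have decomp : ∀ A B : LieIdeal ℝ 𝔤, A ⊓ B = ⊥ → A ⊔ B = ⊤ → (∀ x ∈ A, σ x ∈ A) →
      (∀ x ∈ B, σ x ∈ B) → W A ⊔ W B = ⊤ := by
    intro A B hAB hsup hA hB
    rw [eq_top_iff]
    rintro x -
    have hx : (x : 𝔤) ∈ A ⊔ B := hsup ▸ LieSubmodule.mem_top _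
    obtain ⟨a, ha, b, hb, e⟩ := (LieSubmodule.mem_sup _ _ _).1 hx
    have e1 : σ a + a = -(σ b + b) := by
      have := sV x
      rw [← e, map_add] at this
      rw [eq_neg_iff_add_eq_zero, ← sub_eq_zero.2 this]; abel
    have h0 : σ a + a ∈ A ⊓ B := ⟨add_mem (hA a ha) ha, by
      rw [e1]; exact neg_mem (add_mem (hB b hb) hb)⟩
    rw [hAB, LieSubmodule.mem_bot] at h0
    have ha' : a ∈ V := (memV a).2 (eq_neg_of_add_eq_zero_left h0)
    have hb' : b ∈ V := (memV b).2 (eq_neg_of_add_eq_zero_left (by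
      rw [h0] at e1; exact neg_eq_zero.1 e1.symm))
    exact Submodule.mem_sup.2 ⟨⟨a, ha'⟩, ha, ⟨b, hb'⟩, hb, Subtype.ext e⟩
  have half : ∀ A B : LieIdeal ℝ 𝔤, A ⊓ B = ⊥ → A ⊔ B = ⊤ → (∀ x ∈ A, σ x ∈ A) →
      (∀ x ∈ B, σ x ∈ B) → Half w ρ β (W A) (W B) (A : Set 𝔤) := by
    intro A B hAB hsup hA hB
    refine ⟨?_, ?_, ?_, ?_, ?_⟩
    · intro a ha x hx
      apply Subtype.ext
      rw [hρ, brzero A B hAB a ha (x : 𝔤) hx, brzero A B hAB _ (hA a ha) (x : 𝔤) hx]; simp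
    · intro a ha x
      rw [hW, hρ]
      exact A.smul_mem _ (add_mem (lie_mem_left ℝ 𝔤 A _ _ ha) (lie_mem_left ℝ 𝔤 A _ _ (hA a ha)))
    · intro x hx y hy
      exact lie_mem_left ℝ 𝔤 A _ _ hx
    · intro x hx y hy
      exact key A x hx y hy
    · intro x hx h a ha
      apply Subtype.ext
      rw [hρ']
      have hm := hlm _ (hfix a)
      generalize (1/2 : ℝ) • (a + σ a) = g at hm
      induction hm using Submodule.span_induction with
      | mem g hg =>
        obtain ⟨u, v, hu, hv, rfl⟩ := hg
        have t1 : (⟨u, (memV u).2 hu⟩ : V) ∈ W A ⊔ W B := decomp A B hAB hsup hA hB ▸ Submodule.mem_top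
        have t2 : (⟨v, (memV v).2 hv⟩ : V) ∈ W A ⊔ W B := decomp A B hAB hsup hA hB ▸ Submodule.mem_top
        obtain ⟨u1, hu1, u2, hu2, eu⟩ := Submodule.mem_sup.1 t1
        obtain ⟨v1, hv1, v2, hv2, ev⟩ := Submodule.mem_sup.1 t2
        have eu' : u = u1 + u2 := congrArg Subtype.val eu.symm
        have ev' : v = v1 + v2 := congrArg Subtype.val ev.symm
        have z1 := congrArg Subtype.val (h u1 hu1 v1 hv1)
        rw [hρfix _ (hβfix _ _)] at z1
        have c1 := brzero A B hAB u1 hu1 v2 hv2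
        have c2 : ⁅(u2 : 𝔤), (v1 : 𝔤)⁆ = 0 := by
          rw [← lie_skew, brzero A B hAB v1 hv1 u2 hu2, neg_zero]
        have c3 : ⁅⁅(u2 : 𝔤), (v2 : 𝔤)⁆, (x : 𝔤)⁆ = 0 := by
          rw [← lie_skew, brzero A B hAB x hx _ (lie_mem_left ℝ 𝔤 B (u2 : 𝔤) _ hu2), neg_zero]
        have z1' : ⁅⁅(u1 : 𝔤), (v1 : 𝔤)⁆, (x : 𝔤)⁆ = 0 := z1
        rw [eu', ev', add_lie, lie_add, lie_add, c1, c2, add_zero, zero_add, add_lie, c3, z1']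
        simp
      | zero => simp
      | add a b _ _ ha hb => rw [add_lie, ha, hb]; simp
      | smul c a _ ha => rw [smul_lie, ha]; simp
  have Wne : ∀ A : LieIdeal ℝ 𝔤, (∀ x ∈ A, σ x ∈ A) → A ≠ ⊥ → W A ≠ ⊥ := by
    intro A hA hne h0
    apply hne
    apply hideal
    intro x hx
    have h1 : x - σ x ∈ V := by rw [memV]; simp [hσ]
    have h2 : (⟨x - σ x, h1⟩ : V) ∈ W A := by rw [hW]; exact sub_mem hx (hA x hx)
    rw [h0, Submodule.mem_bot] at h2
    exact (sub_eq_zero.1 (congrArg Subtype.val h2)).symm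
  have no_split : ∀ A B : LieIdeal ℝ 𝔤, A ⊓ B = ⊥ → A ⊔ B = ⊤ → (∀ x ∈ A, σ x ∈ A) →
      (∀ x ∈ B, σ x ∈ B) → A ≠ ⊥ → B ≠ ⊥ → False := by
    intro A B hAB hsup hA hB hneA hneB
    have := finrank_case1 qs (half A B hAB hsup hA hB)
      (half B A (by rwa [inf_comm]) (by rwa [sup_comm]) hB hA) (decomp A B hAB hsup hA hB)
      (Wne A hA hneA) (Wne B hB hneB)
    omega
  have hgnt : Nontrivial 𝔤 := by
    obtain ⟨x, hx⟩ := exists_ne (0 : V)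
    exact ⟨(x : 𝔤), 0, fun h => hx (Subtype.ext h)⟩
  have hna : ¬ IsLieAbelian 𝔤 := by
    intro h
    have := LieAlgebra.subsingleton_of_hasTrivialRadical_lie_abelian ℝ 𝔤
    exact not_subsingleton 𝔤 this
  have hbt : (⊤ : LieIdeal ℝ 𝔤) ≠ ⊥ := by
    intro h
    obtain ⟨x, hx⟩ := exists_ne (0 : 𝔤)
    have : x ∈ (⊤ : LieIdeal ℝ 𝔤) := LieSubmodule.mem_top _
    rw [h] at this
    exact hx (by simpa using this)
  refine ⟨?_, hna⟩
  intro I₀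
  by_contra hcon
  push Not at hcon
  obtain ⟨I, hI, hII⟩ := (eq_bot_or_exists_atom_le I₀).resolve_left hcon.1
  have hItop : I ≠ ⊤ := fun h => hcon.2 (top_le_iff.1 (h ▸ hII))
  let I' : LieIdeal ℝ 𝔤 := LieIdeal.comap σ I
  have hI' : ∀ x, x ∈ I' ↔ σ x ∈ I := fun x => LieIdeal.mem_comap
  let A := I ⊔ I'
  have hAσ : ∀ x ∈ A, σ x ∈ A := by
    intro x hx
    obtain ⟨a, ha, b, hb, rfl⟩ := (LieSubmodule.mem_sup _ _ _).1 hx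
    rw [map_add, add_comm]
    exact (LieSubmodule.mem_sup _ _ _).2 ⟨σ b, (hI' b).1 hb, σ a, (hI' _).2 (by rwa [hσ]), rfl⟩
  obtain ⟨B, hB1, hB2, hBσ⟩ : ∃ B : LieIdeal ℝ 𝔤, A ⊓ B = ⊥ ∧ A ⊔ B = ⊤ ∧ ∀ x ∈ B, σ x ∈ B := by
    obtain ⟨B, h1, h2, h3⟩ := exists_compl_max A
    refine ⟨B, h1, h2, ?_⟩
    have := h3 (LieIdeal.comap σ B) (by
      rw [eq_bot_iff]
      rintro x ⟨hxA, hxB⟩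
      have h4 : σ x ∈ A ⊓ B := ⟨hAσ x hxA, LieIdeal.mem_comap.1 hxB⟩
      rw [h1, LieSubmodule.mem_bot] at h4
      rw [LieSubmodule.mem_bot, ← hσ x, h4, map_zero])
    intro x hx
    have h5 : σ x ∈ LieIdeal.comap σ B := LieIdeal.mem_comap.2 (by rwa [hσ])
    exact this h5
  have hAne : A ≠ ⊥ := fun h => hI.1 (le_bot_iff.1 (h ▸ (le_sup_left : I ≤ A)))
  have hBbot : B = ⊥ := by
    by_contra hB
    exact no_split A B hB1 hB2 hAσ hBσ hAne hB
  have hAtop : I ⊔ I' = ⊤ := by rw [hBbot, sup_bot_eq] at hB2; exact hB2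
  have hinf : I ⊓ I' = ⊥ := by
    rcases hI.le_iff.1 (inf_le_left : I ⊓ I' ≤ I) with h | h
    · exact h
    · exfalso
      have h1 : I ≤ I' := h ▸ inf_le_right
      have h2 : I' ≤ I := fun x hx => by
        have := h1 ((hI' x).1 hx)
        rwa [hI', hσ] at this
      apply hItop
      rw [← hAtop, sup_eq_left.2 h2]
  -- second case
  have hρσ : ∀ a, ρ (σ a) = ρ a := by
    intro a; ext x; rw [hρ, hρ, hσ, add_comm]
  let C : Module.End ℝ V →ₗ[ℝ] Module.End ℝ V × Module.End ℝ V :=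
    { toFun := fun a => (a * K₁ - K₁ * a, a * K₂ - K₂ * a)
      map_add' := fun a b => by ext1 <;> simp only [Prod.fst_add, Prod.snd_add] <;> noncomm_ring
      map_smul' := fun c a => by ext1 <;> simp [smul_sub] }
  have hC : ∀ a, C a = 0 ↔ a * K₁ - K₁ * a = 0 ∧ a * K₂ - K₂ * a = 0 := by
    intro a; exact Prod.mk_eq_zero
  have hρbr : ∀ t ∈ I, ∀ s ∈ I, ρ ⁅t, s⁆ = (2 : ℝ) • (ρ t * ρ s - ρ s * ρ t) := by
    intro t ht s hs
    have c1 : ⁅t, σ s⁆ = 0 := brzero I I' hinf t ht _ ((hI' _).2 (by rwa [hσ]))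
    have c2 : ⁅s, σ t⁆ = 0 := brzero I I' hinf s hs _ ((hI' _).2 (by rwa [hσ]))
    have c3 : ⁅σ t, s⁆ = 0 := by rw [← lie_skew, c2, neg_zero]
    ext x
    simp only [LinearMap.smul_apply, LinearMap.sub_apply, Module.End.mul_apply, Submodule.coe_smul,
      Submodule.coe_sub, hρ']
    rw [← lie_lie]
    simp only [smul_lie, lie_smul, add_lie, lie_add, LieHom.map_lie, c1, c3]
    simp only [zero_lie, lie_zero, add_zero, zero_add, smul_add, ← lie_lie]
    module
  have hcC : ∀ t ∈ I, ∀ s ∈ I, C (ρ s) = 0 → C (ρ ⁅t, s⁆) = 0 := by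
    intro t ht s hs h0
    rw [hC] at h0
    have k1 : ρ s * K₁ = K₁ * ρ s := sub_eq_zero.1 h0.1
    have k2 : ρ s * K₂ = K₂ * ρ s := sub_eq_zero.1 h0.2
    have gen : ∀ K : Module.End ℝ V, ρ s * K = K * ρ s →
        (∃ c d e : ℝ, ρ t * K - K * ρ t = c • K₁ + d • K₂ + e • (K₁ * K₂)) →
        ρ ⁅t, s⁆ * K - K * ρ ⁅t, s⁆ = 0 := by
      intro K hK h
      rw [hρbr t ht s hs]
      exact comm_gen (ρ t) (ρ s) K K₁ K₂ k1 k2 hK h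
    rw [hC]
    exact ⟨gen K₁ k1 (qs.Q1 t), gen K₂ k2 (qs.Q2 t)⟩
  let N : LieIdeal ℝ 𝔤 :=
    { I.toSubmodule ⊓ LinearMap.ker (C ∘ₗ ρ) with
      lie_mem := by
        rintro g s ⟨hs, hk⟩
        have hk : C (ρ s) = 0 := hk
        have hg : g ∈ I ⊔ I' := hAtop ▸ LieSubmodule.mem_top _
        obtain ⟨a, ha, b, hb, rfl⟩ := (LieSubmodule.mem_sup _ _ _).1 hg
        have c : ⁅b, s⁆ = 0 := by rw [← lie_skew, brzero I I' hinf s hs b hb, neg_zero]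
        rw [add_lie, c, add_zero]
        exact ⟨lie_mem_left ℝ 𝔤 I a s ha, hcC a ha s hs hk⟩ }
  have hN : ∀ x, x ∈ N ↔ x ∈ I ∧ C (ρ x) = 0 := fun x => Iff.rfl
  have hNI : N ≤ I := fun x hx => ((hN x).1 hx).1
  rcases hI.le_iff.1 hNI with h | h
  · -- injective
    let f : I →ₗ[ℝ] Module.End ℝ V × Module.End ℝ V := C ∘ₗ ρ ∘ₗ I.toSubmodule.subtype
    have hf : Function.Injective f := by
      rw [injective_iff_map_eq_zero]
      intro x hx
      have : (x : 𝔤) ∈ N := (hN _).2 ⟨x.2, hx⟩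
      rw [h, LieSubmodule.mem_bot] at this
      exact Subtype.ext this
    have hr : LinearMap.range f ≤ Submodule.span ℝ (Set.range
        ![((0 : Module.End ℝ V), K₁ * K₂), (-(K₁ * K₂), 0), (K₂, -K₁)]) := by
      rintro _ ⟨x, rfl⟩
      obtain ⟨p, q, r, hc⟩ := qs.cross (x : 𝔤)
      have h1 := hc 1 0 0
      have h2 := hc 0 1 0
      have e1 : Jv K₁ K₂ 1 0 0 = K₁ := by simp [Jv]
      have e2 : Jv K₁ K₂ 0 1 0 = K₂ := by simp [Jv]
      rw [e1] at h1
      rw [e2] at h2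
      have : f x = p • ((0 : Module.End ℝ V), K₁ * K₂) + q • (-(K₁ * K₂), (0 : Module.End ℝ V))
          + r • (K₂, -K₁) := by
        have : f x = (ρ x * K₁ - K₁ * ρ x, ρ x * K₂ - K₂ * ρ x) := rfl
        rw [this, h1, h2]
        exact pair_eq K₁ K₂ p q r
      rw [this]
      exact add_mem (add_mem (Submodule.smul_mem _ _ (Submodule.subset_span ⟨0, rfl⟩))
        (Submodule.smul_mem _ _ (Submodule.subset_span ⟨1, rfl⟩)))
        (Submodule.smul_mem _ _ (Submodule.subset_span ⟨2, rfl⟩))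
    have d1 : Module.finrank ℝ I ≤ 3 := by
      rw [← LinearMap.finrank_range_of_inj hf]
      exact (Submodule.finrank_mono hr).trans (finrank_range_le_card _)
    have hsurj : Function.Surjective (π ∘ₗ I.toSubmodule.subtype) := by
      intro x
      have hx : (x : 𝔤) ∈ I ⊔ I' := hAtop ▸ LieSubmodule.mem_top _
      obtain ⟨a, ha, b, hb, e⟩ := (LieSubmodule.mem_sup _ _ _).1 hx
      refine ⟨⟨a - σ b, sub_mem ha ((hI' b).1 hb)⟩, ?_⟩
      apply Subtype.ext
      show (π (a - σ b) : 𝔤) = x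
      have e2 := sV x
      rw [hπ, map_sub, hσ]
      have : (x : 𝔤) = (1/2 : ℝ) • ((x : 𝔤) - σ x) := by rw [e2]; module
      rw [this, ← e, map_add]
      module
    have d2 : Module.finrank ℝ V ≤ Module.finrank ℝ I := LinearMap.finrank_le_finrank_of_surjective hsurj
    omega
  · have hall : ∀ a, C (ρ a) = 0 := by
      intro g
      have hg : g ∈ I ⊔ I' := hAtop ▸ LieSubmodule.mem_top _
      obtain ⟨a, ha, b, hb, rfl⟩ := (LieSubmodule.mem_sup _ _ _).1 hg
      have h1 : C (ρ a) = 0 := ((hN a).1 (h ▸ ha)).2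
      have h2 : C (ρ (σ b)) = 0 := ((hN _).1 (h ▸ (hI' b).1 hb)).2
      rw [map_add, map_add, ← hρσ b, h1, h2, add_zero]
    have ht := half ⊤ ⊥ (by simp) (by simp) (by simp) (by simp)
    have := flat qs ht (half_orth qs ht) (decomp ⊤ ⊥ (by simp) (by simp) (by simp) (by simp))
      (by simp [hW]) (by simp [hW])
      (fun a _ x => congrArg (fun f : Module.End ℝ V => f x) (sub_eq_zero.1 ((hC _).1 (hall a)).1))
      (fun a _ x => congrArg (fun f : Module.End ℝ V => f x) (sub_eq_zero.1 ((hC _).1 (hall a)).2))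
    exact Wne ⊤ (by simp) hbt this
end
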